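/- arXiv:2511.23363 — 4 statements merged into one kernel-verified Lean document; each statement's English description precedes it below -/
import Mathlib

section
/- Let (G,+) and (H,⊕) be finite groups, let k ≥ 1, let ε ∈ (0,1), and let f : G → H be a function with ε_f ≥ ε (i.e., f is ε-far from every homomorphism). Then the fraction of tuples (σ,x) ∈ {+1,−1}^{2k} × G^{2k} for which ⊕_{i=1}^{2k} σ_i f(x_i) ≠ f(Σ_{i=1}^{2k} σ_i x_i) is at least min{ (2k−3)·ε/3 , 1/16 }. -/
/-- Apply a sign to a group element: `true` is `+` (identity), `false` is `-` (inverse). -/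
def applySign {G : Type*} [Group G] (b : Bool) (g : G) : G := if b then g else g⁻¹

/-- Signed product `σ₁x₁ ⋯ σₖxₖ`, taken in increasing index order. -/
def sProd {G : Type*} [Group G] {k : ℕ} (σ : Fin k → Bool) (x : Fin k → G) : G :=
  (List.ofFn fun i => applySign (σ i) (x i)).prod

/-- Relative Hamming distance between two functions on a finite domain. -/
noncomputable def hdist {G H : Type*} [Fintype G] (f g : G → H) : ℝ :=
  (Nat.card {x : G // f x ≠ g x} : ℝ) / (Fintype.card G : ℝ)

/-- Distance from `f` to the set of group homomorphisms `G →* H`. -/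
noncomputable def epsF {G H : Type*} [Fintype G] [Group G] [Group H] (f : G → H) : ℝ :=
  sInf (Set.range fun h : G →* H => hdist f ⇑h)

open scoped BigOperators

open Classical in
/-- The real-valued indicator of a proposition. -/
noncomputable def indic (P : Prop) : ℝ := if P then 1 else 0

/-- The probability of an event under the uniform measure on a finite type. -/
noncomputable def prob {α : Type*} [Fintype α] (P : α → Prop) : ℝ := 𝔼 a, indic (P a)

lemma indic_of {P : Prop} (h : P) : indic P = 1 := by simp [indic, h]

lemma indic_of_not {P : Prop} (h : ¬P) : indic P = 0 := by simp [indic, h]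

lemma indic_nonneg (P : Prop) : 0 ≤ indic P := by unfold indic; split_ifs <;> norm_num

lemma indic_mul_self (P : Prop) : indic P * indic P = indic P := by
  unfold indic; split_ifs <;> norm_num

lemma indic_le_add {P Q R : Prop} (h : P → Q ∨ R) : indic P ≤ indic Q + indic R := by
  unfold indic; split_ifs <;> first | (norm_num; done) | tauto

section Prob

variable {α β : Type*} [Fintype α] [Fintype β]

lemma prob_nonneg (P : α → Prop) : 0 ≤ prob P :=
  Finset.expect_nonneg fun _ _ => indic_nonneg _

lemma prob_congr {P Q : α → Prop} (h : ∀ a, P a ↔ Q a) : prob P = prob Q :=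
  congrArg prob (funext fun a => propext (h a))

lemma prob_equiv (e : α ≃ β) (P : β → Prop) : prob (fun a => P (e a)) = prob P :=
  Fintype.expect_equiv e _ _ fun _ => rfl

lemma prob_le_add {P Q R : α → Prop} (h : ∀ a, P a → Q a ∨ R a) : prob P ≤ prob Q + prob R := by
  unfold prob
  rw [← Finset.expect_add_distrib]
  exact Finset.expect_le_expect fun a _ => indic_le_add (h a)

lemma prob_mono {P Q : α → Prop} (h : ∀ a, P a → Q a) : prob P ≤ prob Q :=
  Finset.expect_le_expect fun a _ => by
    have := h a
    unfold indic; split_ifs <;> first | (norm_num; done) | tauto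

lemma prob_not [Nonempty α] (P : α → Prop) : prob (fun a => ¬P a) = 1 - prob P := by
  unfold prob
  rw [← Fintype.expect_one (ι := α) (M := ℝ), ← Finset.expect_sub_distrib]
  refine Finset.expect_congr rfl fun a _ => ?_
  by_cases h : P a <;> simp [indic, h]

lemma exists_not_and_not [Nonempty α] {P Q : α → Prop} {p q : ℝ} (hP : prob P < p)
    (hQ : prob Q < q) (hpq : p + q ≤ 1) : ∃ a, ¬P a ∧ ¬Q a := by
  by_contra! hc
  have h1 : prob (fun a => ¬P a) ≤ prob Q := prob_mono hc
  rw [prob_not] at h1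
  linarith

lemma exists_not_and_not_and_not [Nonempty α] {P Q R : α → Prop} {p q r : ℝ} (hP : prob P < p)
    (hQ : prob Q < q) (hR : prob R < r) (hpqr : p + q + r ≤ 1) : ∃ a, ¬P a ∧ ¬Q a ∧ ¬R a := by
  have hQR : prob (fun a => Q a ∨ R a) < q + r :=
    (prob_le_add fun _ h => h).trans_lt (add_lt_add hQ hR)
  obtain ⟨a, ha, hb⟩ := exists_not_and_not hP hQR (by linarith)
  exact ⟨a, ha, not_or.1 hb⟩

lemma expect_expect_comm (φ : α → β → ℝ) : 𝔼 a, 𝔼 b, φ a b = 𝔼 b, 𝔼 a, φ a b :=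
  Finset.expect_comm _ _ _

lemma exists_expect_lt [Nonempty α] {φ : α → ℝ} {c : ℝ} (h : 𝔼 a, φ a < c) : ∃ a, φ a < c := by
  obtain ⟨a, -, ha⟩ := Finset.exists_lt_of_expect_lt Finset.univ_nonempty h
  exact ⟨a, ha⟩

lemma expect_lt_of_forall_lt [Nonempty α] {φ : α → ℝ} {c : ℝ} (h : ∀ a, φ a < c) :
    𝔼 a, φ a < c :=
  Finset.expect_lt (fun a _ => (h a).le) ⟨Classical.arbitrary α, Finset.mem_univ _, h _⟩

lemma prob_prod (P : α × β → Prop) : prob P = 𝔼 a, prob fun b => P (a, b) := by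
  unfold prob
  rw [← Finset.univ_product_univ, Finset.expect_product]

lemma prob_eq_card_div (P : α → Prop) :
    prob P = (Nat.card {a // P a} : ℝ) / (Fintype.card α : ℝ) := by
  classical
  unfold prob indic
  rw [Fintype.expect_eq_sum_div_card, Finset.sum_boole, Nat.card_eq_fintype_card,
    Fintype.card_subtype]

end Prob

lemma expect_cons {X : Type*} [Fintype X] {j : ℕ} (φ : (Fin (j + 1) → X) → ℝ) :
    𝔼 p, φ p = 𝔼 q, 𝔼 p, φ (Fin.cons q p) := by
  rw [← Finset.expect_product', Finset.univ_product_univ]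
  exact (Fintype.expect_equiv (Fin.consEquiv fun _ => X) _ _ fun _ => rfl).symm

lemma expect_sum_letters {X : Type*} [Fintype X] [Nonempty X] (b : X → ℝ) (j : ℕ) :
    𝔼 p : Fin j → X, ∑ i, b (p i) = j * 𝔼 x, b x := by
  induction j with
  | zero => simp
  | succ j ih =>
    rw [expect_cons]
    simp only [Fin.sum_univ_succ, Fin.cons_zero, Fin.cons_succ, Finset.expect_add_distrib,
      Fintype.expect_const, ih]
    push_cast; ring

lemma expect_sum_sq {X : Type*} [Fintype X] [Nonempty X] (b : X → ℝ) (hb : ∀ x, b x * b x = b x)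
    (j : ℕ) : 𝔼 p : Fin j → X, (∑ i, b (p i)) ^ 2 =
      j * (𝔼 x, b x) + j * (j - 1) * (𝔼 x, b x) ^ 2 := by
  induction j with
  | zero => simp
  | succ j ih =>
    rw [expect_cons]
    have key : ∀ (q : X) (p : Fin j → X), (b q + ∑ i, b (p i)) ^ 2 =
        b q + 2 * b q * (∑ i, b (p i)) + (∑ i, b (p i)) ^ 2 := fun q p => by
      linear_combination hb q
    simp only [Fin.sum_univ_succ, Fin.cons_zero, Fin.cons_succ, key, Finset.expect_add_distrib,
      Fintype.expect_const, ih, ← Finset.mul_expect, expect_sum_letters, ← Finset.expect_mul]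
    push_cast; ring

section Words

variable {G H : Type*}

open Classical in
/-- The indicator that `f` and `g` disagree at `x`. -/
noncomputable def disagree (f g : G → H) (x : G) : ℕ := if f x = g x then 0 else 1

/-- The number of letters of a word on which `f` and `g` disagree. -/
noncomputable def badCount (f g : G → H) {j : ℕ} (p : Fin j → Bool × G) : ℕ :=
  ∑ i, disagree f g (p i).2

lemma badCount_cast (f g : G → H) {j : ℕ} (p : Fin j → Bool × G) :
    (badCount f g p : ℝ) = ∑ i, indic (f (p i).2 ≠ g (p i).2) := by
  rw [badCount, Nat.cast_sum]
  refine Finset.sum_congr rfl fun i _ => ?_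
  by_cases h : f (p i).2 = g (p i).2 <;> simp [disagree, indic, h]

lemma badCount_cons_of_eq (f g : G → H) {j : ℕ} {q : Bool × G} (hq : f q.2 = g q.2)
    (p : Fin j → Bool × G) :
    badCount f g (Fin.cons q p : Fin (j + 1) → Bool × G) = badCount f g p := by
  have h : disagree f g q.2 = 0 := if_pos hq
  simp [badCount, Fin.sum_univ_succ, h]

lemma badCount_cons_of_ne (f g : G → H) {j : ℕ} {q : Bool × G} (hq : f q.2 ≠ g q.2)
    (p : Fin j → Bool × G) :
    badCount f g (Fin.cons q p : Fin (j + 1) → Bool × G) = 1 + badCount f g p := by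
  have h : disagree f g q.2 = 1 := if_neg hq
  simp [badCount, Fin.sum_univ_succ, h]

variable [Group H]

/-- The signed product of the values of `f` along a word in signed letters. -/
def wordProd (f : G → H) {j : ℕ} (p : Fin j → Bool × G) : H :=
  sProd (fun i => (p i).1) fun i => f (p i).2

lemma wordProd_cons (f : G → H) {j : ℕ} (q : Bool × G) (p : Fin j → Bool × G) :
    wordProd f (Fin.cons q p : Fin (j + 1) → Bool × G) =
      applySign q.1 (f q.2) * wordProd f p := by
  simp [wordProd, sProd, List.ofFn_succ]

lemma wordProd_zero (f : G → H) (p : Fin 0 → Bool × G) : wordProd f p = 1 := by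
  simp [wordProd, sProd]

lemma applySign_injective (s : Bool) : Function.Injective (applySign s : H → H) := by
  cases s
  · exact inv_injective
  · exact Function.injective_id

lemma wordProd_eq_of_badCount_eq_zero (f g : G → H) {j : ℕ} (p : Fin j → Bool × G)
    (hp : badCount f g p = 0) : wordProd f p = wordProd g p := by
  induction j with
  | zero => simp [wordProd_zero]
  | succ j ih =>
    obtain ⟨q, p, rfl⟩ : ∃ q p', p = Fin.cons q p' := ⟨p 0, Fin.tail p, by simp⟩
    by_cases hq : f q.2 = g q.2
    · rw [badCount_cons_of_eq f g hq] at hp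
      rw [wordProd_cons, wordProd_cons, hq, ih p hp]
    · rw [badCount_cons_of_ne f g hq] at hp
      omega

lemma wordProd_ne_of_badCount_eq_one (f g : G → H) {j : ℕ} (p : Fin j → Bool × G)
    (hp : badCount f g p = 1) : wordProd f p ≠ wordProd g p := by
  induction j with
  | zero => simp [badCount] at hp
  | succ j ih =>
    obtain ⟨q, p, rfl⟩ : ∃ q p', p = Fin.cons q p' := ⟨p 0, Fin.tail p, by simp⟩
    rw [wordProd_cons, wordProd_cons]
    by_cases hq : f q.2 = g q.2
    · rw [badCount_cons_of_eq f g hq] at hp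
      rw [hq]
      exact fun h => ih p hp (mul_left_cancel h)
    · rw [badCount_cons_of_ne f g hq] at hp
      rw [wordProd_eq_of_badCount_eq_zero f g p (by omega)]
      exact fun h => hq (applySign_injective _ (mul_right_cancel h))

variable [Group G]

lemma applySign_hom_mul (h : G →* H) (c : H) (hcomm : ∀ x, h x * c = c * h x) (hc : c * c = 1)
    (s : Bool) (x : G) : applySign s (h x * c) = h (applySign s x) * c := by
  cases s
  · have hc' : c⁻¹ = c := inv_eq_of_mul_eq_one_left hc
    simp only [applySign, Bool.false_eq_true, if_false, mul_inv_rev, hc', ← map_inv, hcomm]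
  · simp [applySign]

lemma wordProd_hom_mul (h : G →* H) (c : H) (hcomm : ∀ x, h x * c = c * h x) (hc : c * c = 1)
    {j : ℕ} (p : Fin j → Bool × G) :
    wordProd (fun x => h x * c) p = h (wordProd id p) * c ^ j := by
  induction j with
  | zero => simp [wordProd_zero]
  | succ j ih =>
    obtain ⟨q, p, rfl⟩ : ∃ q p', p = Fin.cons q p' := ⟨p 0, Fin.tail p, by simp⟩
    rw [wordProd_cons, wordProd_cons, ih, applySign_hom_mul h c hcomm hc, map_mul, pow_succ',
      mul_assoc, mul_assoc, ← mul_assoc c, ← hcomm, mul_assoc, id]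

variable [Fintype G]

lemma expect_applySign_mul (φ : G → ℝ) (z : G) :
    𝔼 q : Bool × G, φ (applySign q.1 q.2 * z) = 𝔼 x, φ x := by
  rw [← Finset.univ_product_univ, Finset.expect_product]
  have key : ∀ s : Bool, 𝔼 x, φ (applySign s x * z) = 𝔼 x, φ x := by
    rintro (_ | _)
    · exact Fintype.expect_equiv ((Equiv.inv G).trans (Equiv.mulRight z)) _ _
        fun x => by simp [applySign]
    · exact Fintype.expect_equiv (Equiv.mulRight z) _ _ fun x => by simp [applySign]
  simp only [key, Fintype.expect_const]

lemma expect_mul_wordProd (φ : G → ℝ) (j : ℕ) (w : G) :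
    𝔼 p : Fin (j + 1) → Bool × G, φ (w * wordProd id p) = 𝔼 x, φ x := by
  rw [expect_cons, expect_expect_comm]
  simp only [wordProd_cons, id]
  have key : ∀ p : Fin j → Bool × G,
      𝔼 q : Bool × G, φ (w * (applySign q.1 q.2 * wordProd id p)) = 𝔼 x, φ x := fun p =>
    (expect_applySign_mul (fun x => φ (w * x)) _).trans
      (Fintype.expect_equiv (Equiv.mulLeft w) _ _ fun _ => rfl)
  exact (Finset.expect_congr rfl fun p _ => key p).trans (Fintype.expect_const _)

lemma expect_wordProd (φ : G → ℝ) (j : ℕ) :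
    𝔼 p : Fin (j + 1) → Bool × G, φ (wordProd id p) = 𝔼 x, φ x := by
  simpa using expect_mul_wordProd φ j 1

lemma expect_sum_mul_wordProd (b : Bool × G → ℝ) (φ : G → ℝ) (j : ℕ) :
    𝔼 p : Fin (j + 2) → Bool × G, (∑ i, b (p i)) * φ (wordProd id p) =
      (j + 2) * (𝔼 q, b q) * 𝔼 x, φ x := by
  rw [expect_cons]
  simp only [Fin.sum_univ_succ (n := j + 1), Fin.cons_zero, Fin.cons_succ, wordProd_cons, id,
    add_mul, Finset.expect_add_distrib, ← Finset.mul_expect, expect_mul_wordProd]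
  rw [expect_expect_comm]
  simp only [← Finset.mul_expect, expect_applySign_mul, ← Finset.expect_mul, expect_sum_letters]
  push_cast; ring

/-- The probability that a random word with `j` letters witnesses that `f` is not
multiplicative relative to `F`. -/
noncomputable def failProb (f F : G → H) (j : ℕ) : ℝ :=
  prob fun p : Fin j → Bool × G => wordProd f p ≠ F (wordProd id p)

lemma exists_failProb_le (f F : G → H) (j : ℕ) : ∃ F', failProb f F' j ≤ failProb f F (j + 1) := by
  have h : failProb f F (j + 1) = 𝔼 q : Bool × G,
      failProb f (fun z => (applySign q.1 (f q.2))⁻¹ * F (applySign q.1 q.2 * z)) j := by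
    unfold failProb prob
    rw [expect_cons]
    simp only [wordProd_cons, id, ne_eq, eq_inv_mul_iff_mul_eq]
  obtain ⟨q, -, hq⟩ := Finset.exists_le_of_expect_le Finset.univ_nonempty h.ge
  exact ⟨_, hq⟩

lemma exists_failProb_le_of_le (f F : G → H) {i j : ℕ} (hij : i ≤ j) :
    ∃ F', failProb f F' i ≤ failProb f F j := by
  induction j, hij using Nat.le_induction generalizing F with
  | base => exact ⟨F, le_rfl⟩
  | succ j _ ih =>
    obtain ⟨F₁, h₁⟩ := exists_failProb_le f F j
    obtain ⟨F₂, h₂⟩ := ih F₁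
    exact ⟨F₂, h₂.trans h₁⟩

/-- The failure probability of the two-letter test with a prescribed sign pattern. -/
noncomputable def pairFail (f F : G → H) (s t : Bool) : ℝ :=
  𝔼 x, prob fun y => applySign s (f x) * applySign t (f y) ≠ F (applySign s x * applySign t y)

lemma pairFail_nonneg (f F : G → H) (s t : Bool) : 0 ≤ pairFail f F s t :=
  Finset.expect_nonneg fun _ _ => prob_nonneg _

lemma failProb_two (f F : G → H) : failProb f F 2 =
    (pairFail f F true true + pairFail f F true false + pairFail f F false true +
      pairFail f F false false) / 4 := by
  have h0 : ∀ φ : (Fin 0 → Bool × G) → ℝ, 𝔼 p, φ p = φ Fin.elim0 := fun φ => by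
    rw [Finset.expect_congr rfl fun p _ => congrArg φ (Subsingleton.elim p Fin.elim0)]
    exact Fintype.expect_const _
  have hprod : ∀ φ : Bool × G → ℝ,
      𝔼 q, φ q = ((𝔼 x, φ (true, x)) + 𝔼 x, φ (false, x)) / 2 := fun φ => by
    rw [← Finset.univ_product_univ, Finset.expect_product, Fintype.expect_eq_sum_div_card]
    simp
  unfold failProb pairFail prob
  rw [expect_cons]
  simp only [expect_cons (j := 0), h0, wordProd_cons, wordProd_zero, mul_one, id, hprod,
    ← Finset.expect_div, Finset.expect_add_distrib]
  ring

lemma prob_ne_inv_le (f F : G → H) (t : Bool) :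
    prob (fun x => f x ≠ (f x⁻¹)⁻¹) ≤ pairFail f F true t + pairFail f F false t := by
  have h1 : pairFail f F false t =
      𝔼 x, prob fun y => (f x⁻¹)⁻¹ * applySign t (f y) ≠ F (x * applySign t y) :=
    Fintype.expect_equiv (Equiv.inv G) _ _ fun x => by simp [applySign]
  have h2 : prob (fun x => f x ≠ (f x⁻¹)⁻¹) = 𝔼 x, prob fun _ : G => f x ≠ (f x⁻¹)⁻¹ := by
    simp only [prob, Fintype.expect_const]
  rw [h1, h2, pairFail, ← Finset.expect_add_distrib]
  refine Finset.expect_le_expect fun x _ => prob_le_add fun y hxy => ?_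
  by_contra! hc
  simp only [applySign, if_true] at hc
  exact hxy (mul_right_cancel (hc.1.trans hc.2.symm))

lemma exists_hom_near_of_pairFail_lt (f F : G → H) (hd : pairFail f F false true < 1 / 8) :
    ∃ (h : G →* H) (c : H), prob (fun x => f x ≠ h x * c) < 3 / 20 := by
  have hcoll : ∀ u, 𝔼 z, prob (fun y => f (u * y) * (f y)⁻¹ ≠ f (u * z) * (f z)⁻¹) < 1 / 4 := by
    intro u
    have hshift : pairFail f F false true =
        𝔼 z, prob fun y => (f (u * z))⁻¹ * f (u * y) ≠ F (z⁻¹ * y) := by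
      refine (Fintype.expect_equiv (Equiv.mulLeft u) _ _ fun z => ?_).symm
      refine (prob_congr fun y => ?_).trans (prob_equiv (Equiv.mulLeft u) _)
      simp [applySign, mul_assoc]
    have hle : 𝔼 z, prob (fun y => f (u * y) * (f y)⁻¹ ≠ f (u * z) * (f z)⁻¹) ≤
        pairFail f F false true + pairFail f F false true := by
      nth_rewrite 2 [hshift]
      rw [pairFail, ← Finset.expect_add_distrib]
      refine Finset.expect_le_expect fun z _ => prob_le_add fun y hy => ?_
      by_contra! hc
      simp only [applySign, if_true, Bool.false_eq_true, if_false] at hc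
      apply hy
      have h3 := hc.1.trans hc.2.symm
      rw [inv_mul_eq_iff_eq_mul] at h3
      rw [h3]
      group
    linarith
  choose z hz using fun u => exists_expect_lt (hcoll u)
  set g : G → H := fun u => f (u * z u) * (f (z u))⁻¹ with hg
  have hgf : ∀ u, prob (fun y => f (u * y) ≠ g u * f y) < 1 / 4 := fun u => by
    refine lt_of_eq_of_lt (prob_congr fun y => ?_) (hz u)
    rw [ne_eq, ne_eq, mul_inv_eq_iff_eq_mul]
  have hmul : ∀ u v, g (u * v) = g u * g v := fun u v => by
    have h1 : prob (fun y => f (u * (v * y)) ≠ g u * f (v * y)) < 1 / 4 :=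
      lt_of_eq_of_lt (prob_equiv (Equiv.mulLeft v) fun y => f (u * y) ≠ g u * f y) (hgf u)
    obtain ⟨y, hy1, hy2, hy3⟩ :=
      exists_not_and_not_and_not h1 (hgf v) (hgf (u * v)) (by norm_num)
    rw [not_not] at hy1 hy2 hy3
    rw [mul_assoc, hy1, hy2, ← mul_assoc] at hy3
    exact (mul_right_cancel hy3).symm
  let h : G →* H := MonoidHom.mk' g hmul
  have havg := expect_lt_of_forall_lt hgf
  have havg' : 𝔼 y, prob (fun u => f (u * y) ≠ g u * f y) < 1 / 4 := by
    unfold prob at havg ⊢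
    rwa [expect_expect_comm] at havg
  obtain ⟨y, hy⟩ := exists_expect_lt havg'
  set c : H := (g y)⁻¹ * f y with hc
  have hnear : prob (fun x => f x ≠ g x * c) < 1 / 4 := by
    rw [← prob_equiv (Equiv.mulRight y)]
    refine lt_of_eq_of_lt (prob_congr fun u => ?_) hy
    simp [hmul, hc, mul_assoc]
  refine ⟨h, c, ?_⟩
  change prob (fun x => f x ≠ g x * c) < 3 / 20
  set η := prob (fun x => f x ≠ g x * c) with hη
  have hη0 : 0 ≤ η := prob_nonneg _
  set b : G → ℝ := fun x => indic (f x ≠ g x * c) with hb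
  have hE : 𝔼 u, 𝔼 y, (b y + b (u * y) - 2 * (b y * b (u * y))) = η + η - 2 * (η * η) := by
    have hs : ∀ y, 𝔼 u, b (u * y) = η := fun y =>
      Fintype.expect_equiv (Equiv.mulRight y) _ _ fun _ => rfl
    have hs' : 𝔼 y, b y = η := rfl
    rw [expect_expect_comm]
    simp only [Finset.expect_sub_distrib, Finset.expect_add_distrib, ← Finset.mul_expect, hs,
      Fintype.expect_const, hs', ← Finset.expect_mul]
  have hE' : 𝔼 u, 𝔼 y, (b y + b (u * y) - 2 * (b y * b (u * y))) < 1 / 4 := by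
    refine lt_of_le_of_lt (Finset.expect_le_expect fun u _ =>
      Finset.expect_le_expect fun y _ => ?_) havg
    by_cases h1 : f y = g y * c <;> by_cases h2 : f (u * y) = g (u * y) * c
    · simp only [hb, indic_of_not (not_not.2 h1), indic_of_not (not_not.2 h2)]
      simpa using indic_nonneg _
    · rw [indic_of]
      · simp only [hb, indic_of_not (not_not.2 h1), indic_of h2]; norm_num
      · change f (u * y) ≠ g u * f y
        rwa [h1, ← mul_assoc, ← hmul]
    · rw [indic_of]
      · simp only [hb, indic_of_not (not_not.2 h2), indic_of h1]; norm_num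
      · change f (u * y) ≠ g u * f y
        rw [h2, hmul, mul_assoc]
        exact fun h3 => h1 (mul_left_cancel h3).symm
    · simp only [hb, indic_of h1, indic_of h2]
      norm_num
      exact indic_nonneg _
  rw [hE] at hE'
  by_contra! hcon
  nlinarith [mul_nonneg (sub_nonneg.2 hcon) (sub_nonneg.2 hnear.le)]

lemma pairFail_true_false_eq (f F : G → H) :
    pairFail f F true false = pairFail (fun x => (f x⁻¹)⁻¹) F false true := by
  refine Fintype.expect_equiv (Equiv.inv G) _ _ fun x => ?_
  refine ((prob_equiv (Equiv.inv G) _).symm).trans (prob_congr fun y => ?_)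
  simp [applySign]

lemma exists_hom_near (f F : G → H) (hd : failProb f F 2 < 1 / 16) :
    ∃ (h : G →* H) (c : H), prob (fun x => f x ≠ h x * c) < 3 / 20 := by
  have h4 := failProb_two f F
  have n1 := pairFail_nonneg f F true true
  have n2 := pairFail_nonneg f F false false
  rcases lt_or_ge (pairFail f F false true) (1 / 8) with h1 | h1
  · exact exists_hom_near_of_pairFail_lt f F h1
  · have h2 : pairFail f F true false < 1 / 8 := by linarith
    rw [pairFail_true_false_eq] at h2
    obtain ⟨h, c, hc⟩ := exists_hom_near_of_pairFail_lt _ F h2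
    refine ⟨(MulAut.conj c⁻¹).toMonoidHom.comp h, c⁻¹, ?_⟩
    rw [← prob_equiv (Equiv.inv G)]
    refine lt_of_eq_of_lt (prob_congr fun x => ?_) hc
    simp [inv_eq_iff_eq_inv]

lemma prob_ne_inv_lt (f F : G → H) (hd : failProb f F 2 < 1 / 16) :
    prob (fun x => f x ≠ (f x⁻¹)⁻¹) < 1 / 8 := by
  have h4 := failProb_two f F
  have h1 := prob_ne_inv_le f F true
  have h2 := prob_ne_inv_le f F false
  linarith

lemma commute_and_mul_self_eq_one (f : G → H) (h : G →* H) (c : H)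
    (h1 : prob (fun x => f x ≠ h x * c) < 3 / 20)
    (h2 : prob (fun x => f x ≠ (f x⁻¹)⁻¹) < 1 / 8) :
    (∀ x, h x * c = c * h x) ∧ c * c = 1 := by
  have h1' : prob (fun x => f x⁻¹ ≠ h x⁻¹ * c) < 3 / 20 :=
    lt_of_eq_of_lt (prob_equiv (Equiv.inv G) fun x => f x ≠ h x * c) h1
  have hS : prob (fun x => h x * c ≠ c⁻¹ * h x) < 1 / 2 := by
    have ha : prob (fun x => h x * c ≠ c⁻¹ * h x) ≤
        prob (fun x => f x ≠ h x * c) +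
          prob fun x => f x⁻¹ ≠ h x⁻¹ * c ∨ f x ≠ (f x⁻¹)⁻¹ := by
      refine prob_le_add fun x hx => ?_
      by_contra! hc
      obtain ⟨e1, e2, e3⟩ := hc
      apply hx
      rw [← e1, e3, e2]
      simp
    have hb := prob_le_add (P := fun x => f x⁻¹ ≠ h x⁻¹ * c ∨ f x ≠ (f x⁻¹)⁻¹)
      fun x hx => hx
    linarith
  have hinv : ∀ x, h x * c⁻¹ = c⁻¹ * h x := fun x => by
    have hS' : prob (fun y => h (x * y) * c ≠ c⁻¹ * h (x * y)) < 1 / 2 :=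
      lt_of_eq_of_lt (prob_equiv (Equiv.mulLeft x) fun y => h y * c ≠ c⁻¹ * h y) hS
    obtain ⟨y, hy1, hy2⟩ := exists_not_and_not hS hS' (by norm_num)
    rw [not_not] at hy1 hy2
    rw [map_mul, mul_assoc, hy1, ← mul_assoc, ← mul_assoc] at hy2
    exact mul_right_cancel hy2
  have hcomm : ∀ x, h x * c = c * h x := fun x => by
    have := hinv x
    rw [mul_inv_eq_iff_eq_mul, mul_assoc, eq_inv_mul_iff_mul_eq] at this
    exact this.symm
  obtain ⟨y, hy, -⟩ := exists_not_and_not hS hS (by norm_num)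
  rw [not_not, ← hinv] at hy
  exact ⟨hcomm, mul_eq_one_iff_eq_inv.2 (mul_left_cancel hy)⟩

/-- A word fails whenever exactly one of its letters and its value is bad; the second moment
method bounds the probability of this event from below. -/
lemma le_failProb (f F : G → H) (h : G →* H) (c : H) (hcomm : ∀ x, h x * c = c * h x)
    (hc : c * c = 1) {j : ℕ} (hj : 2 ≤ j) {η β : ℝ} (hη : prob (fun x => f x ≠ h x * c) = η)
    (hβ : prob (fun x => F x ≠ h x * c ^ j) = β) :
    j * η * (1 - (j - 1) * η) + β * (1 - 2 * j * η) ≤ failProb f F j := by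
  obtain ⟨j, rfl⟩ : ∃ i, j = i + 2 := ⟨j - 2, by omega⟩
  set b : Bool × G → ℝ := fun q => indic (f q.2 ≠ h q.2 * c) with hb
  set φ : G → ℝ := fun x => indic (F x ≠ h x * c ^ (j + 2)) with hφ
  have hbη : 𝔼 q, b q = η := by
    rw [← hη, ← Finset.univ_product_univ, Finset.expect_product]
    exact Fintype.expect_const _
  have hφβ : 𝔼 x, φ x = β := hβ
  have hpt : ∀ p : Fin (j + 2) → Bool × G,
      2 * (∑ i, b (p i)) + φ (wordProd id p) - (∑ i, b (p i)) ^ 2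
        - 2 * ((∑ i, b (p i)) * φ (wordProd id p)) ≤
        indic (wordProd f p ≠ F (wordProd id p)) := by
    intro p
    have hN : ∑ i, b (p i) = badCount f (fun x => h x * c) p := (badCount_cast f (fun x => h x * c) p).symm
    have hw := wordProd_hom_mul h c hcomm hc p
    have h0 := wordProd_eq_of_badCount_eq_zero f (fun x => h x * c) p
    have h1 := wordProd_ne_of_badCount_eq_one f (fun x => h x * c) p
    rw [hw] at h0 h1
    rw [hN]
    set N := badCount f (fun x => h x * c) p
    have hnn := indic_nonneg (wordProd f p ≠ F (wordProd id p))
    by_cases hF : F (wordProd id p) = h (wordProd id p) * c ^ (j + 2)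
    · have hφ0 : φ (wordProd id p) = 0 := indic_of_not (not_not.2 hF)
      rw [hφ0]
      rcases Nat.lt_or_ge N 2 with hN2 | hN2
      · interval_cases hNv : N
        · simpa using hnn
        · rw [indic_of (by rw [hF]; exact h1 rfl)]
          norm_num
      · have : (2 : ℝ) ≤ N := by exact_mod_cast hN2
        nlinarith
    · have hφ1 : φ (wordProd id p) = 1 := indic_of hF
      rw [hφ1]
      rcases Nat.eq_zero_or_pos N with hN0 | hN0
      · rw [indic_of (by rw [h0 hN0]; exact fun e => hF e.symm), hN0]
        norm_num
      · have : (1 : ℝ) ≤ N := by exact_mod_cast hN0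
        nlinarith
  have hE := Finset.expect_le_expect (s := Finset.univ) fun p _ => hpt p
  simp only [Finset.expect_sub_distrib, Finset.expect_add_distrib, ← Finset.mul_expect,
    expect_sum_letters, expect_sum_sq b (fun q => indic_mul_self _), expect_sum_mul_wordProd,
    expect_wordProd φ (j + 1), hbη, hφβ] at hE
  refine le_trans (le_of_eq ?_) hE
  push_cast; ring

lemma mul_prob_lt (f F : G → H) (h : G →* H) (c : H) (hcomm : ∀ x, h x * c = c * h x)
    (hc : c * c = 1) {m : ℕ} (hm : failProb f F m < 1 / 16) {η : ℝ}
    (hη : prob (fun x => f x ≠ h x * c) = η) (hη' : η < 3 / 20) {j : ℕ} (hj : 2 ≤ j)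
    (hjm : j ≤ m) : j * η < 1 / 12 := by
  have hη0 : 0 ≤ η := hη ▸ prob_nonneg _
  have key : ∀ i : ℕ, 2 ≤ i → i ≤ m → i * η ≤ 1 / 2 → i * η * (1 - (i - 1) * η) < 1 / 16 := by
    intro i hi him hiη
    obtain ⟨F', hF'⟩ := exists_failProb_le_of_le f F him
    have h1 := le_failProb f F' h c hcomm hc hi hη rfl
    have h2 : 0 ≤ prob (fun x => F' x ≠ h x * c ^ i) * (1 - 2 * i * η) :=
      mul_nonneg (prob_nonneg _) (by linarith)
    linarith
  induction j, hj using Nat.le_induction with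
  | base =>
    have h1 := key 2 le_rfl hjm (by push_cast; linarith)
    push_cast at h1 ⊢
    nlinarith
  | succ i hi ih =>
    have h1 := ih (by omega)
    have hi' : (2 : ℝ) ≤ i := by exact_mod_cast hi
    have h3 : 2 * η ≤ i * η := mul_le_mul_of_nonneg_right hi' hη0
    have h2 := key (i + 1) (by omega) hjm (by push_cast; linarith)
    push_cast at h2 ⊢
    nlinarith [mul_nonneg (mul_nonneg (show (0 : ℝ) ≤ i + 1 by linarith) hη0)
      (sub_nonneg.2 h1.le)]

lemma le_failProb_self (f : G → H) {m : ℕ} (hm : 4 ≤ m) (hme : Even m)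
    (hδ : failProb f f m < 1 / 16) :
    ∃ h : G →* H, m * prob (fun x => f x ≠ h x) * (11 / 12) ≤ failProb f f m := by
  obtain ⟨F, hF⟩ := exists_failProb_le_of_le f f (show 2 ≤ m by omega)
  obtain ⟨h, c, hnear⟩ := exists_hom_near f F (hF.trans_lt hδ)
  obtain ⟨hcomm, hc⟩ :=
    commute_and_mul_self_eq_one f h c hnear (prob_ne_inv_lt f F (hF.trans_lt hδ))
  have hpow : c ^ m = 1 := by
    obtain ⟨r, rfl⟩ := hme
    rw [← two_mul, pow_mul, pow_two, hc, one_pow]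
  obtain ⟨η, hη⟩ : ∃ η, prob (fun x => f x ≠ h x * c) = η := ⟨_, rfl⟩
  have hη0 : 0 ≤ η := hη ▸ prob_nonneg _
  have hmη := mul_prob_lt f f h c hcomm hc hδ hη (hη ▸ hnear) (show 2 ≤ m by omega) le_rfl
  have hm' : (4 : ℝ) ≤ m := by exact_mod_cast hm
  have hmη0 : 0 ≤ m * η := by positivity
  have hmain := le_failProb f f h c hcomm hc (show 2 ≤ m by omega) hη rfl
  simp only [hpow, mul_one] at hmain
  have hβ0 : 0 ≤ prob fun x => f x ≠ h x := prob_nonneg _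
  have hfirst : m * η * (11 / 12) ≤ m * η * (1 - (m - 1) * η) :=
    mul_le_mul_of_nonneg_left (by linarith) hmη0
  by_cases hc1 : c = 1
  · subst hc1
    simp only [mul_one] at hη
    refine ⟨h, ?_⟩
    rw [hη] at hmain hβ0 ⊢
    have : 0 ≤ η * (1 - 2 * m * η) := mul_nonneg hβ0 (by linarith)
    linarith
  · exfalso
    have hβ : 1 - η ≤ prob fun x => f x ≠ h x := by
      rw [← hη, ← prob_not]
      refine prob_mono fun x hx => ?_
      rw [not_not.1 hx]
      simpa using hc1
    have h4 : 4 * η ≤ m * η := mul_le_mul_of_nonneg_right hm' hη0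
    have : (1 - η) * (5 / 6) ≤ (prob fun x => f x ≠ h x) * (1 - 2 * m * η) :=
      mul_le_mul hβ (by linarith) (by norm_num) hβ0
    linarith

end Words

lemma epsF_le {G H : Type*} [Fintype G] [Group G] [Group H] (f : G → H) (h : G →* H) :
    epsF f ≤ prob fun x => f x ≠ h x := by
  rw [prob_eq_card_div]
  refine csInf_le ⟨0, ?_⟩ ⟨h, rfl⟩
  rintro _ ⟨g, rfl⟩
  exact div_nonneg (Nat.cast_nonneg _) (Nat.cast_nonneg _)

theorem stmt0 {G H : Type*} [Group G] [Group H] [Fintype G] [Fintype H]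
    (k : ℕ) (hk : 1 ≤ k) (ε : ℝ) (hε0 : 0 < ε) (hε1 : ε < 1)
    (f : G → H) (hfar : ε ≤ epsF f) :
    min ((2 * (k : ℝ) - 3) * ε / 3) (1 / 16) ≤
      (Nat.card {p : (Fin (2 * k) → Bool) × (Fin (2 * k) → G) //
          sProd p.1 (fun i => f (p.2 i)) ≠ f (sProd p.1 p.2)} : ℝ) /
        (Nat.card ((Fin (2 * k) → Bool) × (Fin (2 * k) → G)) : ℝ) := by
  have hrhs : failProb f f (2 * k) =
      (Nat.card {p : (Fin (2 * k) → Bool) × (Fin (2 * k) → G) //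
          sProd p.1 (fun i => f (p.2 i)) ≠ f (sProd p.1 p.2)} : ℝ) /
        (Nat.card ((Fin (2 * k) → Bool) × (Fin (2 * k) → G)) : ℝ) := by
    rw [Nat.card_eq_fintype_card (α := (Fin (2 * k) → Bool) × (Fin (2 * k) → G)),
      ← prob_eq_card_div, ← prob_equiv (Equiv.arrowProdEquivProdArrow (Fin (2 * k)) _ _)]
    rfl
  rw [← hrhs]
  rcases Nat.lt_or_ge k 2 with hk2 | hk2
  · obtain rfl : k = 1 := by omega
    refine (min_le_left _ _).trans (le_trans ?_ (prob_nonneg _))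
    push_cast
    linarith
  · rcases lt_or_ge (failProb f f (2 * k)) (1 / 16) with hδ | hδ
    · obtain ⟨h, hh⟩ := le_failProb_self f (by omega) (even_two_mul k) hδ
      refine (min_le_left _ _).trans (le_trans ?_ hh)
      have h1 : ε ≤ prob fun x => f x ≠ h x := hfar.trans (epsF_le f h)
      have hk' : (2 : ℝ) ≤ k := by exact_mod_cast hk2
      have h2 := mul_le_mul_of_nonneg_left h1 (show (0 : ℝ) ≤ 2 * k by positivity)
      push_cast
      nlinarith [mul_pos (show (0 : ℝ) < k by linarith) hε0]
    · exact (min_le_right _ _).trans hδ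
end

section
/- Let (G,+) and (H,⊕) be finite groups, let k ≥ 1, and let f : G → H be a function with ε_f < 1/8. Then the fraction of tuples (σ,x) ∈ {+1,−1}^k × G^k for which ⊕_{i=1}^{k} σ_i f(x_i) ≠ f(Σ_{i=1}^{k} σ_i x_i) is at least min{ (k−3)·ε_f/3 , 1/6 }. -/
/-- Splitting off the first letter of a word of length `k + 1`. -/
theorem sum_fin_succ_arrow {α : Type*} [Fintype α] (k : ℕ) (F : (Fin (k + 1) → α) → ℝ) :
    ∑ x, F x = ∑ t : Fin k → α, ∑ q : α, F (Fin.cons q t) := by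
  rw [← (Fin.consEquiv fun _ : Fin (k + 1) => α).sum_comp, Fintype.sum_prod_type,
    Finset.sum_comm]
  rfl

/-- The empirical mass of the words on which the products of `a` and `c` agree satisfies the
same recursion as the probability that a binomial variable is even. -/
theorem sum_prod_eq_le {α H : Type*} [Fintype α] [Group H] [DecidableEq H] (a c : α → H)
    (ε : ℝ) (hε : ∑ q, (if a q ≠ c q then (1 : ℝ) else 0) = ε * Fintype.card α)
    (hε2 : ε ≤ 1 / 2) (k : ℕ) :
    ∑ x : Fin k → α, (if (List.ofFn fun i => a (x i)).prod = (List.ofFn fun i => c (x i)).prod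
        then (1 : ℝ) else 0)
      ≤ (Fintype.card α : ℝ) ^ k * ((1 + (1 - 2 * ε) ^ k) / 2) := by
  induction k with
  | zero => simp
  | succ k ih =>
    set m : ℝ := (Fintype.card α : ℝ) with hm
    have hm0 : 0 ≤ m := by positivity
    rw [sum_fin_succ_arrow]
    have hstep : ∀ t : Fin k → α,
        ∑ q : α, (if (List.ofFn fun i => a ((Fin.cons q t : Fin (k + 1) → α) i)).prod
            = (List.ofFn fun i => c ((Fin.cons q t : Fin (k + 1) → α) i)).prod
          then (1 : ℝ) else 0)
        ≤ m * ε + m * (1 - 2 * ε) *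
          (if (List.ofFn fun i => a (t i)).prod = (List.ofFn fun i => c (t i)).prod
            then (1 : ℝ) else 0) := by
      intro t
      simp only [List.ofFn_succ, Fin.cons_zero, Fin.cons_succ, List.prod_cons]
      split_ifs with h
      · simp only [h, mul_left_inj]
        have : ∀ q, (if a q = c q then (1 : ℝ) else 0) = 1 - (if a q ≠ c q then (1 : ℝ) else 0) := by
          intro q
          by_cases hq : a q = c q <;> simp [hq]
        simp only [this, Finset.sum_sub_distrib, hε]
        simp only [Finset.sum_const, Finset.card_univ, nsmul_eq_mul, ← hm]
        linarith
      · have : ∀ q, (if a q * (List.ofFn fun i => a (t i)).prod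
            = c q * (List.ofFn fun i => c (t i)).prod then (1 : ℝ) else 0)
            ≤ if a q ≠ c q then (1 : ℝ) else 0 := by
          intro q
          by_cases hq : a q = c q
          · simp [hq, h]
          · simp only [ne_eq, hq, not_false_eq_true, if_true]
            split_ifs <;> norm_num
        calc _ ≤ _ := Finset.sum_le_sum fun q _ => this q
          _ = _ := by rw [hε]; ring
    calc _ ≤ _ := Finset.sum_le_sum fun t _ => hstep t
      _ = m ^ k * (m * ε) + m * (1 - 2 * ε) * _ := by
        rw [Finset.sum_add_distrib, Finset.sum_const, Finset.card_univ, nsmul_eq_mul,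
          Fintype.card_fun, Fintype.card_fin, Nat.cast_pow, ← Finset.mul_sum]
      _ ≤ m ^ k * (m * ε) + m * (1 - 2 * ε) * (m ^ k * ((1 + (1 - 2 * ε) ^ k) / 2)) := by
        have : 0 ≤ m * (1 - 2 * ε) := mul_nonneg hm0 (by linarith)
        gcongr
      _ = _ := by ring

/-- If every translate of `a` hits `S` with mass `u`, then so do products of words. -/
theorem sum_prod_mem_eq {α K : Type*} [Fintype α] [Group K] (a : α → K) (S : K → Prop)
    [DecidablePred S] (u : ℝ) (hu : ∀ B, ∑ q, (if S (a q * B) then (1 : ℝ) else 0) = u) (k : ℕ) :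
    ∑ x : Fin (k + 1) → α, (if S (List.ofFn fun i => a (x i)).prod then (1 : ℝ) else 0)
      = (Fintype.card α : ℝ) ^ k * u := by
  rw [sum_fin_succ_arrow]
  simp [List.ofFn_succ, hu]

theorem epsF_attained {G H : Type*} [Fintype G] [Fintype H] [Group G] [Group H] (f : G → H) :
    ∃ h : G →* H, hdist f h = epsF f := by
  have : Finite (G →* H) := DFunLike.finite _
  exact (Set.range_nonempty fun h : G →* H => hdist f ⇑h).csInf_mem (Set.finite_range _)

theorem sum_applySign {G : Type*} [Fintype G] [Group G] (F : G → ℝ) :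
    ∑ q : Bool × G, F (applySign q.1 q.2) = 2 * ∑ g, F g := by
  rw [Fintype.sum_prod_type, Fintype.sum_bool]
  simp only [applySign, if_true, Bool.false_eq_true, if_false]
  have h : ∑ g : G, F g⁻¹ = ∑ g, F g := Equiv.sum_comp (Equiv.inv G) F
  rw [h, two_mul]

theorem map_applySign {G H : Type*} [Group G] [Group H] (h : G →* H) (b : Bool) (g : G) :
    h (applySign b g) = applySign b (h g) := by
  cases b <;> simp [applySign]

theorem applySign_injective_s1 {G : Type*} [Group G] (b : Bool) :
    Function.Injective (applySign b : G → G) := by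
  cases b <;> intro x y <;> simp [applySign]

theorem min_le_of_bernoulli (k : ℕ) (ε : ℝ) (h0 : 0 ≤ ε) (h1 : ε < 1 / 8) :
    min (((k : ℝ) - 3) * ε / 3) (1 / 6) ≤ (1 - (1 - 2 * ε) ^ k) / 2 - ε := by
  set s : ℝ := 2 * k * ε with hs
  have hs0 : 0 ≤ s := by positivity
  have hp : (1 - 2 * ε) ^ k ≤ 1 / (1 + s) := by
    have h2 : 1 + s ≤ (1 + 2 * ε) ^ k := by
      have := one_add_mul_le_pow (a := 2 * ε) (by linarith) k
      linarith
    have h3 : (1 - 2 * ε) ^ k * (1 + 2 * ε) ^ k ≤ 1 := by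
      rw [← mul_pow]
      exact pow_le_one₀ (mul_nonneg (by linarith) (by linarith)) (by nlinarith)
    rw [le_div_iff₀ (by positivity)]
    exact (mul_le_mul_of_nonneg_left h2 (pow_nonneg (by linarith) k)).trans h3
  rcases le_total s 2 with h | h
  · have : 1 / (1 + s) ≤ 1 - s / 3 := by
      rw [div_le_iff₀ (by positivity)]
      nlinarith
    exact (min_le_left _ _).trans (by linarith)
  · have : 1 / (1 + s) ≤ 1 / 3 := one_div_le_one_div_of_le (by norm_num) (by linarith)
    exact (min_le_right _ _).trans (by linarith)

theorem natCard_subtype_eq_sum {α : Type*} [Fintype α] (P : α → Prop) [DecidablePred P] :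
    (Nat.card {x // P x} : ℝ) = ∑ x, if P x then (1 : ℝ) else 0 := by
  rw [Nat.card_eq_fintype_card, Fintype.card_subtype, Finset.sum_boole]

theorem stmt1 {G H : Type*} [Group G] [Group H] [Fintype G] [Fintype H]
    (k : ℕ) (hk : 1 ≤ k) (f : G → H) (hclose : epsF f < 1 / 8) :
    min (((k : ℝ) - 3) * epsF f / 3) (1 / 6) ≤
      (Nat.card {p : (Fin k → Bool) × (Fin k → G) //
          sProd p.1 (fun i => f (p.2 i)) ≠ f (sProd p.1 p.2)} : ℝ) /
        (Nat.card ((Fin k → Bool) × (Fin k → G)) : ℝ) := by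
  classical
  obtain ⟨h, hh⟩ := epsF_attained f
  set ε := epsF f with hεdef
  have hn : (0 : ℝ) < Fintype.card G := by exact_mod_cast Fintype.card_pos
  have h0 : 0 ≤ ε := by rw [← hh, hdist]; positivity
  have hd : ∑ g, (if f g ≠ h g then (1 : ℝ) else 0) = ε * Fintype.card G := by
    rw [hdist, div_eq_iff hn.ne', natCard_subtype_eq_sum] at hh
    exact hh
  have hm : (Fintype.card (Bool × G) : ℝ) = 2 * Fintype.card G := by simp
  set m : ℝ := (Fintype.card (Bool × G) : ℝ) with hmdef
  have hm0 : 0 < m := by rw [hm]; positivity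
  have hagree := sum_prod_eq_le (fun q : Bool × G => applySign q.1 (f q.2))
    (fun q => applySign q.1 (h q.2)) ε (by
      simp only [ne_eq, (applySign_injective_s1 _).eq_iff, Fintype.sum_prod_type, Fintype.sum_bool]
      simp only [ne_eq] at hd
      rw [hd, ← hmdef, hm]; ring) (by linarith) k
  have hout : ∑ x : Fin k → Bool × G,
      (if f (List.ofFn fun i => applySign (x i).1 (x i).2).prod
          ≠ h (List.ofFn fun i => applySign (x i).1 (x i).2).prod then (1 : ℝ) else 0)
        = m ^ k * ε := by
    obtain ⟨j, rfl⟩ := Nat.exists_eq_add_of_le' hk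
    rw [sum_prod_mem_eq (fun q : Bool × G => applySign q.1 q.2) (fun y => f y ≠ h y) (m * ε)]
    · rw [← hmdef]; ring
    · intro B
      have hB : ∑ g, (if f (g * B) ≠ h (g * B) then (1 : ℝ) else 0) = ε * Fintype.card G :=
        (Equiv.sum_comp (Equiv.mulRight B) fun g => if f g ≠ h g then (1 : ℝ) else 0).trans hd
      rw [sum_applySign (fun g => if f (g * B) ≠ h (g * B) then (1 : ℝ) else 0), hB, hm]
      ring
  have hcard : (Nat.card ((Fin k → Bool) × (Fin k → G)) : ℝ) = m ^ k := by
    rw [hm, Nat.card_eq_fintype_card]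
    simp [mul_pow]
  rw [hcard, le_div_iff₀ (by positivity), natCard_subtype_eq_sum,
    ← (Equiv.arrowProdEquivProdArrow (Fin k) (fun _ => Bool) (fun _ => G)).sum_comp]
  have hpt : ∀ x : Fin k → Bool × G,
      1 - (if (List.ofFn fun i => applySign (x i).1 (f (x i).2)).prod
          = (List.ofFn fun i => applySign (x i).1 (h (x i).2)).prod then (1 : ℝ) else 0)
        - (if f (List.ofFn fun i => applySign (x i).1 (x i).2).prod
          ≠ h (List.ofFn fun i => applySign (x i).1 (x i).2).prod then (1 : ℝ) else 0)
      ≤ if (List.ofFn fun i => applySign (x i).1 (f (x i).2)).prod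
          ≠ f (List.ofFn fun i => applySign (x i).1 (x i).2).prod then (1 : ℝ) else 0 := by
    intro x
    have hx : h (List.ofFn fun i => applySign (x i).1 (x i).2).prod
        = (List.ofFn fun i => applySign (x i).1 (h (x i).2)).prod := by
      rw [map_list_prod, List.map_ofFn]
      simp only [Function.comp_def, map_applySign]
    rw [← hx]
    split_ifs <;> first | (norm_num; done) | simp_all
  have hsum := Finset.sum_le_sum fun x (_ : x ∈ Finset.univ) => hpt x
  rw [Finset.sum_sub_distrib, Finset.sum_sub_distrib, hout] at hsum
  have hone : ∑ _x : Fin k → Bool × G, (1 : ℝ) = m ^ k := by simp [hmdef]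
  rw [hone] at hsum
  refine le_trans ?_ hsum
  have := mul_le_mul_of_nonneg_right (min_le_of_bernoulli k ε h0 hclose) (pow_nonneg hm0.le k)
  refine this.trans ?_
  simp only [← hmdef] at hagree
  linarith
end

section
/- Let (G,+) and (H,⊕) be finite groups, let k ≥ 1, let f : G → H be a function, and let μ be the fraction of tuples (σ,x) ∈ {+1,−1}^{2k} × G^{2k} for which ⊕_{i=1}^{2k} σ_i f(x_i) ≠ f(Σ_{i=1}^{2k} σ_i x_i). If μ < 1/10, then there exists a homomorphism g : G → H with dist(f,g) ≤ 2μ. -/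
/-- The fraction of the elements of a finite type that satisfy `P`. -/
noncomputable def frac {α : Type*} (P : α → Prop) : ℝ :=
  (Nat.card {x : α // P x} : ℝ) / (Nat.card α : ℝ)

open scoped Classical in
theorem frac_eq_sum {α : Type*} [Fintype α] (P : α → Prop) :
    frac P = (∑ x, if P x then (1 : ℝ) else 0) / (Fintype.card α : ℝ) := by
  simp [frac, Fintype.card_subtype, Nat.card_eq_fintype_card]

theorem frac_nonneg {α : Type*} (P : α → Prop) : 0 ≤ frac P := by
  unfold frac; positivity

theorem frac_mono {α : Type*} [Finite α] {P Q : α → Prop} (h : ∀ x, P x → Q x) :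
    frac P ≤ frac Q := by
  unfold frac
  gcongr
  exact Nat.card_le_card_of_injective _ (Subtype.map_injective h Function.injective_id)

theorem frac_or_le {α : Type*} [Finite α] (P Q : α → Prop) :
    frac (fun x => P x ∨ Q x) ≤ frac P + frac Q := by
  classical
  have := Fintype.ofFinite α
  simp only [frac_eq_sum, ← add_div, ← Finset.sum_add_distrib]
  gcongr with x
  by_cases hP : P x <;> by_cases hQ : Q x <;> simp [hP, hQ]

theorem frac_not {α : Type*} [Finite α] [Nonempty α] (P : α → Prop) :
    frac (fun x => ¬ P x) = 1 - frac P := by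
  classical
  have := Fintype.ofFinite α
  have hc : (Fintype.card α : ℝ) ≠ 0 := by simp
  rw [eq_sub_iff_add_eq]
  simp only [frac_eq_sum, ← add_div, ← Finset.sum_add_distrib]
  rw [div_eq_one_iff_eq hc, ← nsmul_one, ← Finset.card_univ, ← Finset.sum_const]
  refine Finset.sum_congr rfl fun x _ => ?_
  by_cases hP : P x <;> simp [hP]

theorem exists_not_of_frac_lt_one {α : Type*} [Finite α] [Nonempty α] {P : α → Prop}
    (h : frac P < 1) : ∃ x, ¬ P x := by
  by_contra! hP
  have := frac_not P
  have h0 : frac (fun x => ¬ P x) = 0 := by simp [frac, hP]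
  linarith

theorem frac_comp_equiv {α β : Type*} (e : α ≃ β) (P : β → Prop) :
    frac (fun x => P (e x)) = frac P := by
  unfold frac
  rw [Nat.card_congr e, Nat.card_congr (e.subtypeEquiv (p := fun x => P (e x)) (q := P)
    fun _ => Iff.rfl)]

theorem frac_prod {α β : Type*} [Fintype α] [Finite β] (P : α × β → Prop) :
    frac P = (∑ a, frac fun b => P (a, b)) / (Fintype.card α : ℝ) := by
  classical
  have := Fintype.ofFinite β
  simp only [frac_eq_sum, Fintype.sum_prod_type, ← Finset.sum_div, Fintype.card_prod]
  rw [div_div, Nat.cast_mul, mul_comm]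

theorem frac_prod_le {α β : Type*} [Finite α] [Finite β] [Nonempty α] {P : α × β → Prop} {t : ℝ}
    (h : ∀ a, frac (fun b => P (a, b)) ≤ t) : frac P ≤ t := by
  have := Fintype.ofFinite α
  rw [frac_prod, div_le_iff₀ (by simp [Fintype.card_pos]), mul_comm, ← nsmul_eq_mul,
    ← Finset.card_univ, ← Finset.sum_const]
  exact Finset.sum_le_sum fun a _ => h a

theorem exists_frac_le {α β : Type*} [Finite α] [Finite β] [Nonempty α] {P : α × β → Prop}
    {t : ℝ} (ht : frac P ≤ t) : ∃ a, frac (fun b => P (a, b)) ≤ t := by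
  refine (?_ : ∃ a, frac (fun b => P (a, b)) ≤ frac P).imp fun a ha => ha.trans ht
  have := Fintype.ofFinite α
  by_contra! h
  have h2 := Finset.sum_lt_sum_of_nonempty Finset.univ_nonempty fun a (_ : a ∈ Finset.univ) => h a
  rw [Finset.sum_const, nsmul_eq_mul, frac_prod P, Finset.card_univ,
    mul_div_cancel₀ _ (by simp)] at h2
  exact lt_irrefl _ h2

theorem frac_prod_ite {α β : Type*} [Finite α] [Finite β] [Nonempty α] {P : α → Prop}
    {Q : α × β → Prop} {s t : ℝ} (hs : ∀ a, P a → s ≤ frac fun b => Q (a, b))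
    (ht : ∀ a, ¬ P a → t ≤ frac fun b => Q (a, b)) :
    frac P * s + (1 - frac P) * t ≤ frac Q := by
  classical
  have := Fintype.ofFinite α
  rw [← frac_not, frac_prod, frac_eq_sum, frac_eq_sum, div_mul_eq_mul_div, div_mul_eq_mul_div,
    ← add_div, Finset.sum_mul, Finset.sum_mul, ← Finset.sum_add_distrib]
  gcongr with a
  by_cases h : P a
  · simpa [h] using hs a h
  · simpa [h] using ht a h

theorem frac_fst {α β : Type*} [Finite α] [Finite β] [Nonempty β] (P : α → Prop) :
    frac (fun p : α × β => P p.1) = frac P := by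
  have hc : (Nat.card β : ℝ) ≠ 0 := by exact_mod_cast Nat.card_pos.ne'
  unfold frac
  rw [Nat.card_prod, Nat.card_congr (Equiv.prodSubtypeFstEquivSubtypeProd (p := P) (β := β)),
    Nat.card_prod, Nat.cast_mul, Nat.cast_mul, mul_div_mul_right _ _ hc]

theorem frac_snd {α β : Type*} [Finite α] [Finite β] [Nonempty α] (P : β → Prop) :
    frac (fun p : α × β => P p.2) = frac P :=
  (frac_comp_equiv (Equiv.prodComm α β) fun p => P p.1).trans (frac_fst P)

section SignedTest

variable {G H : Type*} [Group G] [Group H]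

theorem applySign_applySign (b : Bool) (x : G) : applySign b (applySign b x) = x := by
  cases b <;> simp [applySign]

/-- The signed value of `f` at the element whose sign `b` multiple is `y`. -/
def signedVal (f : G → H) (p : Bool × G) : H := applySign p.1 (f (applySign p.1 p.2))

theorem signedVal_not_inv (f : G → H) (b : Bool) (y : G) :
    signedVal f (!b, y⁻¹) = (signedVal f (b, y))⁻¹ := by
  cases b <;> simp [signedVal, applySign]

/-- A product of two signed values whose arguments multiply to `a`. -/
def splitVal (f : G → H) (a : G) (s : Bool × Bool × G) : H :=
  signedVal f (s.1, s.2.2) * signedVal f (s.2.1, s.2.2⁻¹ * a)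

/-- Pairs of signed elements, parametrised by their product. -/
def splitEquiv : G × (Bool × Bool × G) ≃ (Bool × G) × (Bool × G) where
  toFun p := ((p.2.1, p.2.2.2), (p.2.2.1, p.2.2.2⁻¹ * p.1))
  invFun q := (q.1.2 * q.2.2, (q.1.1, q.2.1, q.1.2))
  left_inv p := by simp
  right_inv q := by simp

variable [Finite G]

theorem frac_splitVal_ne_splitVal_le {f φ : G → H} {μ : ℝ}
    (h : frac (fun q : (Bool × G) × (Bool × G) =>
      signedVal f q.1 * signedVal f q.2 ≠ φ (q.1.2 * q.2.2)) ≤ μ) (a : G) :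
    frac (fun p : (Bool × Bool × G) × (Bool × Bool × G) =>
      splitVal f a p.2 ≠ splitVal f a p.1) ≤ 2 * μ := by
  let bad : (Bool × G) × (Bool × G) → Prop := fun q =>
    signedVal f q.1 * signedVal f q.2 ≠ φ (q.1.2 * q.2.2)
  let e₁ : (Bool × Bool × G) × (Bool × Bool × G) ≃ ((Bool × G) × (Bool × G)) × (Bool × Bool) :=
    { toFun := fun p => (((!p.1.1, p.1.2.2⁻¹), (p.2.1, p.2.2.2)), (p.1.2.1, p.2.2.1))
      invFun := fun q => ((!q.1.1.1, q.2.1, q.1.1.2⁻¹), (q.1.2.1, q.2.2, q.1.2.2))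
      left_inv := fun p => by simp
      right_inv := fun q => by simp }
  let e₂ : (Bool × Bool × G) × (Bool × Bool × G) ≃ ((Bool × G) × (Bool × G)) × (Bool × Bool) :=
    { toFun := fun p =>
        (((p.1.2.1, p.1.2.2⁻¹ * a), (!p.2.2.1, (p.2.2.2⁻¹ * a)⁻¹)), (p.1.1, p.2.1))
      invFun := fun q =>
        ((q.2.1, q.1.1.1, a * q.1.1.2⁻¹), (q.2.2, !q.1.2.1, a * q.1.2.2))
      left_inv := fun p => by simp
      right_inv := fun q => by simp }
  have h₁ : frac (fun p => bad (e₁ p).1) ≤ μ := by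
    rwa [frac_comp_equiv e₁ fun q => bad q.1, frac_fst]
  have h₂ : frac (fun p => bad (e₂ p).1) ≤ μ := by
    rwa [frac_comp_equiv e₂ fun q => bad q.1, frac_fst]
  refine (frac_mono ?_).trans ((frac_or_le (fun p => bad (e₁ p).1) fun p => bad (e₂ p).1).trans
    (by linarith))
  rintro ⟨⟨b₃, b₄, y'⟩, ⟨b₁, b₂, y⟩⟩ hne
  by_contra! hgood
  obtain ⟨g₁, g₂⟩ := hgood
  simp only [bad, e₁, e₂, Equiv.coe_fn_mk, not_not, signedVal_not_inv] at g₁ g₂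
  apply hne
  have hy : y'⁻¹ * a * (y⁻¹ * a)⁻¹ = y'⁻¹ * y := by group
  rw [hy, ← g₁, mul_inv_eq_iff_eq_mul] at g₂
  simp only [splitVal]
  rw [g₂]
  group

theorem map_mul_of_frac_splitVal {f ψ : G → H} {ε : ℝ} (hε : 3 * ε < 1)
    (h : ∀ a, frac (fun s => splitVal f a s ≠ ψ a) ≤ ε) (a b : G) : ψ (a * b) = ψ a * ψ b := by
  let e₁ : (Bool × Bool × G) × Bool ≃ (Bool × Bool × G) × Bool := Equiv.refl _
  let e₂ : (Bool × Bool × G) × Bool ≃ (Bool × Bool × G) × Bool :=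
    { toFun := fun p => ((!p.1.2.1, p.2, (p.1.2.2⁻¹ * a)⁻¹), p.1.1)
      invFun := fun q => ((q.2, !q.1.1, a * q.1.2.2), q.1.2.1)
      left_inv := fun p => by simp
      right_inv := fun q => by simp }
  let e₃ : (Bool × Bool × G) × Bool ≃ (Bool × Bool × G) × Bool :=
    { toFun := fun p => ((p.1.1, p.2, p.1.2.2), p.1.2.1)
      invFun := fun p => ((p.1.1, p.2, p.1.2.2), p.1.2.1)
      left_inv := fun p => by simp
      right_inv := fun q => by simp }
  have key (e : (Bool × Bool × G) × Bool ≃ (Bool × Bool × G) × Bool) (c : G) :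
      frac (fun p => splitVal f c (e p).1 ≠ ψ c) ≤ ε := by
    rw [frac_comp_equiv e fun q => splitVal f c q.1 ≠ ψ c, frac_fst fun s => splitVal f c s ≠ ψ c]
    exact h c
  have hlt : frac (fun p => splitVal f a (e₁ p).1 ≠ ψ a ∨ splitVal f b (e₂ p).1 ≠ ψ b ∨
      splitVal f (a * b) (e₃ p).1 ≠ ψ (a * b)) < 1 := by
    refine (frac_or_le _ _).trans_lt ?_
    have := frac_or_le (fun p => splitVal f b (e₂ p).1 ≠ ψ b)
      fun p => splitVal f (a * b) (e₃ p).1 ≠ ψ (a * b)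
    linarith [key e₁ a, key e₂ b, key e₃ (a * b)]
  obtain ⟨⟨⟨b₁, b₂, y⟩, b₃⟩, hgood⟩ := exists_not_of_frac_lt_one hlt
  push Not at hgood
  obtain ⟨g₁, g₂, g₃⟩ := hgood
  rw [← g₁, ← g₂, ← g₃]
  simp only [splitVal, e₁, e₂, e₃, Equiv.coe_fn_mk, Equiv.refl_apply, signedVal_not_inv]
  simp [mul_assoc]

/-- If products of two signed values of `f` are usually determined by the product of the
arguments, then they are usually given by a homomorphism. -/
theorem exists_hom_approx {f φ : G → H} {μ : ℝ} (hμ : μ < 1 / 10)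
    (h : frac (fun q : (Bool × G) × (Bool × G) =>
      signedVal f q.1 * signedVal f q.2 ≠ φ (q.1.2 * q.2.2)) ≤ μ) :
    ∃ ψ : G →* H,
      frac (fun q : (Bool × G) × (Bool × G) =>
        signedVal f q.1 * signedVal f q.2 ≠ ψ (q.1.2 * q.2.2)) ≤ 2 * μ ∧
      frac (fun a => φ a ≠ ψ a) ≤ 2 * μ := by
  have hex (a : G) : ∃ c, frac (fun s => splitVal f a s ≠ c) ≤ 2 * μ := by
    obtain ⟨s₀, hs₀⟩ := exists_frac_le (frac_splitVal_ne_splitVal_le h a)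
    exact ⟨splitVal f a s₀, hs₀⟩
  choose ψ hψ using hex
  refine ⟨MonoidHom.mk' ψ (map_mul_of_frac_splitVal (by linarith) hψ), ?_, ?_⟩
  · rw [← frac_comp_equiv splitEquiv]
    refine frac_prod_le fun a => ?_
    simpa [splitEquiv, splitVal] using hψ a
  · rw [← frac_comp_equiv splitEquiv] at h
    have h' := (frac_prod_ite (P := fun a => φ a ≠ ψ a) (s := 1 / 2) (t := 0) (fun a ha => ?_)
      fun a _ => frac_nonneg _).trans h
    · simp only [MonoidHom.mk'_apply]
      linarith
    · have h₁ := frac_not fun s => splitVal f a s ≠ ψ a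
      have h₂ : frac (fun s => ¬ splitVal f a s ≠ ψ a) ≤ frac fun s => splitVal f a s ≠ φ a :=
        frac_mono fun s hs hs' => ha (hs'.symm.trans (not_not.1 hs))
      have h₃ := hψ a
      have : (1 / 2 : ℝ) ≤ frac fun s => splitVal f a s ≠ φ a := by linarith
      simpa [splitEquiv, splitVal] using this

/-- Splitting off the first two entries of a tuple. -/
def consPairEquiv (α : Type*) (n : ℕ) : (α × α) × (Fin n → α) ≃ (Fin (n + 2) → α) where
  toFun p := Fin.cons p.1.1 (Fin.cons p.1.2 p.2)
  invFun v := ((v 0, v 1), fun i => v i.succ.succ)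
  left_inv p := by ext <;> rfl
  right_inv v := by
    ext i
    refine Fin.cases rfl (fun i => Fin.cases rfl (fun i => rfl) i) i

/-- The product of a function along a tuple. -/
def tupleProd {α M : Type*} [Monoid M] {n : ℕ} (F : α → M) (v : Fin n → α) : M :=
  (List.ofFn fun i => F (v i)).prod

theorem tupleProd_consPairEquiv {α M : Type*} [Monoid M] {n : ℕ} (F : α → M)
    (p : (α × α) × (Fin n → α)) :
    tupleProd F (consPairEquiv α n p) = F p.1.1 * F p.1.2 * tupleProd F p.2 := by
  simp [tupleProd, consPairEquiv, List.ofFn_succ, mul_assoc]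

theorem eq_one_of_frac_tupleProd_lt {f : G → H} {ψ : G →* H} {d : H}
    (hpair : frac (fun q : (Bool × G) × (Bool × G) =>
      signedVal f q.1 * signedVal f q.2 ≠ ψ (q.1.2 * q.2.2)) < 1 / 2) (n : ℕ)
    (h : frac (fun v : Fin (2 * n) → Bool × G =>
      tupleProd (signedVal f) v ≠ ψ (tupleProd Prod.snd v) * d) < 1 / 2) : d = 1 := by
  induction n with
  | zero =>
    obtain ⟨v, hv⟩ := exists_not_of_frac_lt_one (h.trans (by norm_num))
    simpa [tupleProd, eq_comm] using hv
  | succ n ih =>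
    apply ih
    rw [← frac_comp_equiv (consPairEquiv (Bool × G) (2 * n))] at h
    simp only [tupleProd_consPairEquiv] at h
    set γ := frac fun v : Fin (2 * n) → Bool × G =>
      tupleProd (signedVal f) v ≠ ψ (tupleProd Prod.snd v) * d with hγ
    have h' := (frac_prod_ite (P := fun q : (Bool × G) × (Bool × G) =>
      signedVal f q.1 * signedVal f q.2 ≠ ψ (q.1.2 * q.2.2)) (s := 1 - γ) (t := γ)
      (fun q hq => ?_) fun q hq => ?_).trans_lt h
    · nlinarith
    · rw [hγ, ← frac_not]
      refine frac_mono fun v hv hv' => hq ?_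
      rw [not_not.1 hv, map_mul ψ (_ * _), mul_assoc (ψ _)] at hv'
      exact mul_right_cancel hv'
    · refine frac_mono fun v hv hv' => hv ?_
      rw [not_not.1 hq, map_mul ψ (_ * _), mul_assoc (ψ _)] at hv'
      exact mul_left_cancel hv'

theorem exists_hom_of_frac_tupleProd {f : G → H} (n : ℕ) {μ : ℝ} (hμ : μ < 1 / 10)
    (h : frac (fun v : Fin (2 * (n + 1)) → Bool × G =>
      tupleProd (signedVal f) v ≠ f (tupleProd Prod.snd v)) ≤ μ) :
    ∃ ψ : G →* H, frac (fun x => f x ≠ ψ x) ≤ 2 * μ := by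
  rw [← frac_comp_equiv (consPairEquiv (Bool × G) (2 * n))] at h
  simp only [tupleProd_consPairEquiv] at h
  have h' := h
  rw [← frac_comp_equiv (Equiv.prodComm (Fin (2 * n) → Bool × G) _)] at h'
  obtain ⟨v₀, hv₀⟩ := exists_frac_le h'
  set p := tupleProd Prod.snd v₀
  set c := tupleProd (signedVal f) v₀
  obtain ⟨ψ, hψ, hφ⟩ := exists_hom_approx (f := f) (φ := fun a => f (a * p) * c⁻¹) hμ <| by
    refine (frac_mono fun q hq hq' => hq ?_).trans hv₀
    exact eq_mul_inv_of_mul_eq hq'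
  have hd : frac (fun x => f x ≠ ψ x * ((ψ p)⁻¹ * c)) ≤ 2 * μ := by
    rw [← frac_comp_equiv (Equiv.mulRight p)]
    refine (frac_mono fun a ha ha' => ha ?_).trans hφ
    rw [mul_inv_eq_iff_eq_mul] at ha'
    simp [ha', mul_assoc]
  have hd1 : (ψ p)⁻¹ * c = 1 := by
    refine eq_one_of_frac_tupleProd_lt (hψ.trans_lt (by linarith)) n ?_
    generalize (ψ p)⁻¹ * c = d at hd
    have hbad : frac (fun r : ((Bool × G) × (Bool × G)) × (Fin (2 * n) → Bool × G) =>
        f (r.1.1.2 * r.1.2.2 * tupleProd Prod.snd r.2) ≠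
          ψ (r.1.1.2 * r.1.2.2 * tupleProd Prod.snd r.2) * d) ≤ 2 * μ := by
      let e : ((Bool × G) × (Bool × G)) × (Fin (2 * n) → Bool × G) ≃
          G × Bool × (Bool × G) × (Fin (2 * n) → Bool × G) :=
        { toFun := fun r => (r.1.1.2 * r.1.2.2 * tupleProd Prod.snd r.2, r.1.1.1, r.1.2, r.2)
          invFun := fun t => (((t.2.1, t.1 * (t.2.2.1.2 * tupleProd Prod.snd t.2.2.2)⁻¹),
            t.2.2.1), t.2.2.2)
          left_inv := fun r => by simp [mul_assoc]
          right_inv := fun t => by simp [mul_assoc] }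
      have := frac_comp_equiv e fun t => f t.1 ≠ ψ t.1 * d
      rw [frac_fst fun x => f x ≠ ψ x * d] at this
      exact this.trans_le hd
    rw [← frac_fst (β := Fin (2 * n) → Bool × G)] at hψ
    rw [← frac_snd (α := (Bool × G) × (Bool × G))]
    have hsum := (frac_or_le _ _).trans (add_le_add ((frac_or_le _ _).trans (add_le_add h hψ)) hbad)
    refine (frac_mono fun r hr => ?_).trans_lt (hsum.trans_lt (by linarith))
    by_contra! hgood
    obtain ⟨⟨g₁, g₂⟩, g₃⟩ := hgood
    apply hr
    rw [g₃, g₂, map_mul ψ (_ * _), mul_assoc (ψ _)] at g₁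
    exact mul_left_cancel g₁
  exact ⟨ψ, by simpa [hd1] using hd⟩

/-- Signs and elements of a test tuple, with each element replaced by its signed version. -/
def signedTupleEquiv (G : Type*) [Group G] (n : ℕ) :
    (Fin n → Bool) × (Fin n → G) ≃ (Fin n → Bool × G) where
  toFun p i := (p.1 i, applySign (p.1 i) (p.2 i))
  invFun v := (fun i => (v i).1, fun i => applySign (v i).1 (v i).2)
  left_inv p := by simp [applySign_applySign]
  right_inv v := by simp [applySign_applySign]

end SignedTest

theorem stmt6 {G H : Type*} [Group G] [Group H] [Fintype G] [Fintype H]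
    (k : ℕ) (hk : 1 ≤ k) (f : G → H) (μ : ℝ)
    (hμ : μ = (Nat.card {p : (Fin (2 * k) → Bool) × (Fin (2 * k) → G) //
          sProd p.1 (fun i => f (p.2 i)) ≠ f (sProd p.1 p.2)} : ℝ) /
        (Nat.card ((Fin (2 * k) → Bool) × (Fin (2 * k) → G)) : ℝ))
    (hsmall : μ < 1 / 10) :
    ∃ g : G →* H, hdist f ⇑g ≤ 2 * μ := by
  obtain ⟨n, rfl⟩ := Nat.exists_eq_add_of_le' hk
  obtain ⟨ψ, hψ⟩ := exists_hom_of_frac_tupleProd (f := f) n hsmall <| by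
    rw [hμ, ← frac_comp_equiv (signedTupleEquiv G _)]
    simp only [frac, tupleProd, signedTupleEquiv, signedVal, sProd, Equiv.coe_fn_mk,
      applySign_applySign]
    exact le_rfl
  exact ⟨ψ, by simpa [frac, hdist] using hψ⟩
end

section
/- Let (G,+) and (H,⊕) be finite groups, let k ≥ 1, let f : G → H be a function, and let μ be the fraction of tuples (σ,x) ∈ {+1,−1}^{2k} × G^{2k} for which ⊕_{i=1}^{2k} σ_i f(x_i) ≠ f(Σ_{i=1}^{2k} σ_i x_i). Then for every a ∈ G there exists an element h ∈ H such that the fraction of tuples (σ,x) ∈ F_a whose vote equals h is at least 1 − 2μ. -/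
open Finset in
/-- If the fibers of `s` all have `c` elements, then the product condition `s t * s u = a`
leaves the first factor uniformly distributed. -/
theorem card_filter_mul_eq {T G : Type*} [Fintype T] [DecidableEq T] [Group G] [DecidableEq G]
    (s : T → G) (c : ℕ) (hc : ∀ b, #{t | s t = b} = c) (a : G) :
    #{p : T × T | s p.1 * s p.2 = a} = Fintype.card T * c := by
  rw [card_eq_sum_card_fiberwise (f := Prod.fst) (t := univ) (fun _ _ => by simp)]
  rw [← card_univ, ← smul_eq_mul, ← sum_const]
  refine sum_congr rfl fun t _ => ?_
  rw [← hc ((s t)⁻¹ * a)]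
  refine card_nbij' Prod.snd (fun u => (t, u)) ?_ ?_ ?_ ?_
  · rintro ⟨t', u⟩ h
    simp only [coe_filter, mem_filter, mem_univ, true_and, Set.mem_ofPred_eq] at h ⊢
    rw [← h.2, ← h.1]; group
  · intro u h
    simp only [coe_filter, mem_filter, mem_univ, true_and, Set.mem_ofPred_eq] at h ⊢
    simp [h]
  · rintro ⟨t', u⟩ h
    simp only [coe_filter, mem_filter, mem_univ, true_and, Set.mem_ofPred_eq] at h ⊢
    rw [h.2]
  · intro u _
    rfl

open Finset in
/-- Abstract collision argument: two independent pairs `p`, `q` with `s p.1 * s p.2 = a` and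
`s q.1 * s q.2 = a` have the same vote unless `(inv q.1, p.1)` or `(q.2, inv p.2)` is bad. -/
theorem exists_popular_vote {T G H : Type*} [Fintype T] [Nonempty T] [DecidableEq T]
    [Group G] [DecidableEq G] [Group H] [DecidableEq H]
    (s : T → G) (v : T → H) (inv : T → T) (hinv : Function.Injective inv)
    (hs : ∀ t, s (inv t) = (s t)⁻¹) (hv : ∀ t, v (inv t) = (v t)⁻¹)
    (c : ℕ) (hc : ∀ b, #{t | s t = b} = c) (f : G → H) (a : G) :
    ∃ h : H, 1 - 2 * ((#{p : T × T | v p.1 * v p.2 ≠ f (s p.1 * s p.2)} : ℝ) /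
          (Fintype.card (T × T) : ℝ)) ≤
        (#{p : T × T | s p.1 * s p.2 = a ∧ v p.1 * v p.2 = h} : ℝ) /
          (#{p : T × T | s p.1 * s p.2 = a} : ℝ) := by
  have hN : 0 < Fintype.card T := Fintype.card_pos
  have hcpos : 0 < c := by
    obtain ⟨t⟩ := ‹Nonempty T›
    rw [← hc (s t)]
    exact card_pos.2 ⟨t, by simp⟩
  have hF := card_filter_mul_eq s c hc a
  set F : Finset (T × T) := {p | s p.1 * s p.2 = a} with hFdef
  set B : Finset (T × T) := {p | v p.1 * v p.2 ≠ f (s p.1 * s p.2)} with hBdef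
  have memF : ∀ p, p ∈ F ↔ s p.1 * s p.2 = a := fun p => by simp [hFdef]
  have card_left : #{r ∈ F ×ˢ F | (inv r.2.1, r.1.1) ∈ B} ≤ c * c * #B := by
    refine card_le_mul_card_image_of_maps_to (f := fun r : (T × T) × (T × T) => (inv r.2.1, r.1.1))
      (fun r hr => (mem_filter.1 hr).2) _ fun b _ => ?_
    rw [← hc ((s b.2)⁻¹ * a)]
    nth_rw 2 [hc]
    rw [← hc (s b.1 * a), ← card_product]
    refine card_le_card_of_injOn (fun r => (r.1.2, r.2.2)) ?_ ?_
    · rintro ⟨⟨p₁, p₂⟩, q₁, q₂⟩ h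
      simp only [coe_filter, mem_filter, mem_product, memF, Set.mem_ofPred_eq] at h
      obtain ⟨⟨⟨hp, hq⟩, -⟩, rfl⟩ := h
      simp only [coe_product, coe_filter, mem_univ, true_and, Set.mem_prod, Set.mem_ofPred_eq, hs]
      exact ⟨by rw [← hp]; group, by rw [← hq]; group⟩
    · rintro ⟨⟨p₁, p₂⟩, q₁, q₂⟩ h ⟨⟨p₁', p₂'⟩, q₁', q₂'⟩ h' e
      simp only [coe_filter, mem_filter, Set.mem_ofPred_eq] at h h'
      have e' := h.2.trans h'.2.symm
      simp only [Prod.mk.injEq] at e e' ⊢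
      exact ⟨⟨e'.2, e.1⟩, hinv e'.1, e.2⟩
  have card_right : #{r ∈ F ×ˢ F | (r.2.2, inv r.1.2) ∈ B} ≤ c * c * #B := by
    refine card_le_mul_card_image_of_maps_to (f := fun r : (T × T) × (T × T) => (r.2.2, inv r.1.2))
      (fun r hr => (mem_filter.1 hr).2) _ fun b _ => ?_
    rw [← hc (a * s b.2)]
    nth_rw 2 [hc]
    rw [← hc (a * (s b.1)⁻¹), ← card_product]
    refine card_le_card_of_injOn (fun r => (r.1.1, r.2.1)) ?_ ?_
    · rintro ⟨⟨p₁, p₂⟩, q₁, q₂⟩ h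
      simp only [coe_filter, mem_filter, mem_product, memF, Set.mem_ofPred_eq] at h
      obtain ⟨⟨⟨hp, hq⟩, -⟩, rfl⟩ := h
      simp only [coe_product, coe_filter, mem_univ, true_and, Set.mem_prod, Set.mem_ofPred_eq, hs]
      exact ⟨by rw [← hp]; group, by rw [← hq]; group⟩
    · rintro ⟨⟨p₁, p₂⟩, q₁, q₂⟩ h ⟨⟨p₁', p₂'⟩, q₁', q₂'⟩ h' e
      simp only [coe_filter, mem_filter, Set.mem_ofPred_eq] at h h'
      have e' := h.2.trans h'.2.symm
      simp only [Prod.mk.injEq] at e e' ⊢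
      exact ⟨⟨e.1, hinv e'.2⟩, e.2, e'.1⟩
  have cover : F ×ˢ F ⊆ {r ∈ F ×ˢ F | v r.2.1 * v r.2.2 = v r.1.1 * v r.1.2} ∪
      ({r ∈ F ×ˢ F | (inv r.2.1, r.1.1) ∈ B} ∪ {r ∈ F ×ˢ F | (r.2.2, inv r.1.2) ∈ B}) := by
    rintro ⟨⟨p₁, p₂⟩, q₁, q₂⟩ h
    simp only [mem_union, mem_filter, h, true_and]
    by_contra! hcon
    obtain ⟨hne, hl, hr⟩ := hcon
    simp only [mem_product, memF] at h
    simp only [hBdef, mem_filter, mem_univ, true_and, not_not, hs, hv] at hl hr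
    have hsum : (s q₁)⁻¹ * s p₁ = s q₂ * (s p₂)⁻¹ := by
      rw [inv_mul_eq_iff_eq_mul, ← mul_assoc, eq_mul_inv_iff_mul_eq, h.1, h.2]
    have hvote := hl.trans ((congrArg f hsum).trans hr.symm)
    rw [inv_mul_eq_iff_eq_mul, ← mul_assoc, eq_mul_inv_iff_mul_eq] at hvote
    exact hne hvote.symm
  have good : #{r ∈ F ×ˢ F | v r.2.1 * v r.2.2 = v r.1.1 * v r.1.2} =
      ∑ p ∈ F, #{q : T × T | s q.1 * s q.2 = a ∧ v q.1 * v q.2 = v p.1 * v p.2} := by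
    simp_rw [← filter_filter]
    rw [card_filter, sum_product]
    simp_rw [← card_filter]
    rfl
  have key : (Fintype.card T * c) * (Fintype.card T * c) ≤
      ∑ p ∈ F, #{q : T × T | s q.1 * s q.2 = a ∧ v q.1 * v q.2 = v p.1 * v p.2} +
        2 * (c * c * #B) := by
    rw [← good, ← hF, ← card_product]
    refine (card_le_card cover).trans ((card_union_le _ _).trans ?_)
    refine Nat.add_le_add_left ((card_union_le _ _).trans ?_) _
    omega
  have hFne : F.Nonempty := card_pos.1 (hF ▸ Nat.mul_pos hN hcpos)
  have hNr : (0 : ℝ) < Fintype.card T := by exact_mod_cast hN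
  have hcr : (0 : ℝ) < c := by exact_mod_cast hcpos
  have keyr : ((Fintype.card T : ℝ) * c) * (Fintype.card T * c) ≤
      ∑ p ∈ F, (#{q : T × T | s q.1 * s q.2 = a ∧ v q.1 * v q.2 = v p.1 * v p.2} : ℝ) +
        2 * (c * c * #B) := by exact_mod_cast key
  obtain ⟨p, -, hp⟩ := exists_le_of_sum_le (s := F)
    (f := fun _ => (1 - 2 * ((#B : ℝ) / (Fintype.card (T × T) : ℝ))) * (Fintype.card T * c))
    (g := fun p => (#{q : T × T | s q.1 * s q.2 = a ∧ v q.1 * v q.2 = v p.1 * v p.2} : ℝ)) hFne (by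
      rw [sum_const, hF, nsmul_eq_mul, Fintype.card_prod]
      push_cast
      refine le_trans (le_of_eq ?_) (sub_le_iff_le_add.2 keyr)
      field_simp)
  refine ⟨v p.1 * v p.2, ?_⟩
  rw [hF, Nat.cast_mul, le_div_iff₀ (mul_pos hNr hcr)]
  exact hp

open Finset in
/-- Equivariance under left translation forces all fibers to have the same size. -/
theorem card_fiber_eq_of_translation {T G : Type*} [Fintype T] [Group G] [DecidableEq G]
    (s : T → G) (τ : G → T → T) (hτ : ∀ g, Function.Injective (τ g))
    (hs : ∀ g t, s (τ g t) = g * s t) (b : G) :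
    #{t | s t = b} = #{t | s t = 1} := by
  have le : ∀ b b', #{t | s t = b} ≤ #{t | s t = b'} := fun b b' =>
    card_le_card_of_injOn (τ (b' * b⁻¹)) (fun t ht => by simp_all) ((hτ _).injOn)
  exact le_antisymm (le _ _) (le _ _)

theorem sProd_append {G : Type*} [Group G] {m n : ℕ} (σ : Fin m → Bool) (ρ : Fin n → Bool)
    (x : Fin m → G) (y : Fin n → G) :
    sProd (Fin.append σ ρ) (Fin.append x y) = sProd σ x * sProd ρ y := by
  unfold sProd
  rw [← List.prod_append, ← List.ofFn_fin_append]
  congr 2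
  funext i
  refine Fin.addCases (fun i => ?_) (fun i => ?_) i <;> simp

theorem applySign_not {G : Type*} [Group G] (b : Bool) (g : G) :
    applySign (!b) g = (applySign b g)⁻¹ := by
  cases b <;> simp [applySign]

theorem sProd_succ {G : Type*} [Group G] {n : ℕ} (σ : Fin (n + 1) → Bool)
    (x : Fin (n + 1) → G) :
    sProd σ x = applySign (σ 0) (x 0) * sProd (fun i => σ i.succ) (fun i => x i.succ) := by
  simp [sProd, List.ofFn_succ]

/-- Reversing the order and flipping all signs inverts a signed product. -/
theorem sProd_rev {G : Type*} [Group G] {n : ℕ} (σ : Fin n → Bool) (x : Fin n → G) :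
    sProd (fun i => !σ i.rev) (fun i => x i.rev) = (sProd σ x)⁻¹ := by
  unfold sProd
  rw [List.prod_inv_reverse, List.map_ofFn]
  congr 1
  apply List.ext_getElem
  · simp
  · intro i h₁ h₂
    simp only [List.length_ofFn] at h₁
    simp only [List.getElem_ofFn, applySign_not, List.getElem_reverse, List.length_ofFn,
      Function.comp_apply]
    congr 3 <;> (ext; simp [Fin.rev]; omega)

/-- Left translation by `g` acting on the first entry of a signed tuple. -/
def translateSigned {G : Type*} [Group G] {n : ℕ} (g : G)
    (p : (Fin (n + 1) → Bool) × (Fin (n + 1) → G)) :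
    (Fin (n + 1) → Bool) × (Fin (n + 1) → G) :=
  (p.1, Fin.cons (if p.1 0 then g * p.2 0 else p.2 0 * g⁻¹) (Fin.tail p.2))

theorem translateSigned_injective {G : Type*} [Group G] {n : ℕ} (g : G) :
    Function.Injective (translateSigned (n := n) g) := by
  rintro ⟨σ, x⟩ ⟨ρ, y⟩ h
  simp only [translateSigned, Prod.mk.injEq, Fin.cons_inj] at h
  obtain ⟨rfl, h0, ht⟩ := h
  rw [← Fin.cons_self_tail x, ← Fin.cons_self_tail y, ht]
  congr 2
  split_ifs at h0 <;> simpa using h0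

theorem sProd_translateSigned {G : Type*} [Group G] {n : ℕ} (g : G)
    (p : (Fin (n + 1) → Bool) × (Fin (n + 1) → G)) :
    sProd (translateSigned g p).1 (translateSigned g p).2 = g * sProd p.1 p.2 := by
  rw [sProd_succ, sProd_succ, ← mul_assoc]
  congr 1
  cases h : p.1 0 <;> simp [translateSigned, applySign, h]

/-- Concatenation of two signed tuples. -/
def appendSignedEquiv (G : Type*) (n : ℕ) :
    ((Fin n → Bool) × (Fin n → G)) × ((Fin n → Bool) × (Fin n → G)) ≃
      (Fin (n + n) → Bool) × (Fin (n + n) → G) :=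
  (Equiv.prodProdProdComm _ _ _ _).trans
    (Equiv.prodCongr (Fin.appendEquiv n n) (Fin.appendEquiv n n))

theorem sProd_appendSignedEquiv {G K : Type*} [Group K] {n : ℕ} (f : G → K)
    (p : ((Fin n → Bool) × (Fin n → G)) × ((Fin n → Bool) × (Fin n → G))) :
    sProd (appendSignedEquiv G n p).1 (fun i => f ((appendSignedEquiv G n p).2 i)) =
      sProd p.1.1 (fun i => f (p.1.2 i)) * sProd p.2.1 (fun i => f (p.2.2 i)) := by
  rw [← sProd_append]
  congr 1
  funext i
  refine Fin.addCases (fun i => ?_) (fun i => ?_) i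
  · rw [Fin.append_left]
    exact congrArg f (Fin.append_left _ _ _)
  · rw [Fin.append_right]
    exact congrArg f (Fin.append_right _ _ _)

theorem stmt7 {G H : Type*} [Group G] [Group H] [Fintype G] [Fintype H]
    (k : ℕ) (hk : 1 ≤ k) (f : G → H) (μ : ℝ)
    (hμ : μ = (Nat.card {p : (Fin (2 * k) → Bool) × (Fin (2 * k) → G) //
          sProd p.1 (fun i => f (p.2 i)) ≠ f (sProd p.1 p.2)} : ℝ) /
        (Nat.card ((Fin (2 * k) → Bool) × (Fin (2 * k) → G)) : ℝ)) :
    ∀ a : G, ∃ h : H,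
      1 - 2 * μ ≤
        (Nat.card {p : (Fin (2 * k) → Bool) × (Fin (2 * k) → G) //
            sProd p.1 p.2 = a ∧ sProd p.1 (fun i => f (p.2 i)) = h} : ℝ) /
          (Nat.card {p : (Fin (2 * k) → Bool) × (Fin (2 * k) → G) //
            sProd p.1 p.2 = a} : ℝ) := by
  classical
  intro a
  obtain ⟨m, rfl⟩ : ∃ m, k = m + 1 := ⟨k - 1, by omega⟩
  obtain ⟨h, hh⟩ := exists_popular_vote
    (T := (Fin (m + 1) → Bool) × (Fin (m + 1) → G))
    (fun t => sProd t.1 t.2) (fun t => sProd t.1 (fun i => f (t.2 i)))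
    (fun t => (fun i => !t.1 i.rev, fun i => t.2 i.rev))
    (by
      rintro ⟨σ, x⟩ ⟨ρ, y⟩ e
      simp only [Prod.mk.injEq] at e ⊢
      exact ⟨funext fun i => by simpa using congrFun e.1 i.rev,
        funext fun i => by simpa using congrFun e.2 i.rev⟩)
    (fun t => sProd_rev _ _) (fun t => sProd_rev t.1 (fun i => f (t.2 i))) _
    (card_fiber_eq_of_translation _ translateSigned translateSigned_injective
      sProd_translateSigned) f a
  refine ⟨h, ?_⟩
  subst hμ
  generalize hn : 2 * (m + 1) = n
  obtain rfl : n = (m + 1) + (m + 1) := by omega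
  let e := appendSignedEquiv G (m + 1)
  have hsum : ∀ p, sProd (e p).1 (e p).2 = sProd p.1.1 p.1.2 * sProd p.2.1 p.2.2 :=
    sProd_appendSignedEquiv id
  have hvote : ∀ p, sProd (e p).1 (fun i => f ((e p).2 i)) = _ := sProd_appendSignedEquiv f
  have transfer : ∀ P : (Fin (m + 1 + (m + 1)) → Bool) × (Fin (m + 1 + (m + 1)) → G) → Prop,
      Nat.card {p // P p} = (Finset.univ.filter fun p => P (e p)).card := fun P => by
    rw [← Fintype.card_subtype, ← Nat.card_eq_fintype_card]
    exact (Nat.card_congr (e.subtypeEquiv fun _ => Iff.rfl)).symm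
  rw [transfer, transfer, transfer, ← Nat.card_congr e, Nat.card_eq_fintype_card]
  simpa only [hsum, hvote] using hh
end
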